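/- Let f : ℝ^d → ℝ be a piecewise affine function (a pointwise min over i ∈ I of functions f_i = max_{j ∈ J(i)}(a_{ij} + ⟨v_{ij}, ·⟩)) with S(f) = {x | f(x) ≤ 0} nonempty. Then f has an error bound on every bounded subset V of ℝ^d: there exists τ > 0 such that τ · dist(x, S(f)) ≤ max{f(x), 0} for all x ∈ V. -/

import Mathlib

open scoped RealInnerProductSpace

section HoffmanBound

variable {E : Type*} [NormedAddCommGroup E] [InnerProductSpace ℝ E] {κ : Type*}

/-- Gordan's alternative: if no vector has negative inner product with every element of a finite
set, then `0` lies in the convex hull of that set. -/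
theorem zero_mem_convexHull_of_forall_exists_inner_nonneg [CompleteSpace E] (T : Finset E)
    (hT : ∀ u : E, ∃ w ∈ T, 0 ≤ ⟪w, u⟫) : (0 : E) ∈ convexHull ℝ (T : Set E) := by
  by_contra h
  obtain ⟨g, c, hc, hg⟩ := geometric_hahn_banach_point_closed (convex_convexHull ℝ (T : Set E))
    (T.finite_toSet.isCompact_convexHull (𝕜 := ℝ)).isClosed h
  obtain ⟨w, hw, hwu⟩ := hT (-((InnerProductSpace.toDual ℝ E).symm g))
  have hgw := hg w (subset_convexHull ℝ _ hw)
  rw [inner_neg_right, real_inner_comm, InnerProductSpace.toDual_symm_apply] at hwu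
  rw [map_zero] at hc
  linarith

/-- An affine system with a Slater point has an error bound on bounded sets. -/
theorem exists_error_bound_of_slater (a : κ → ℝ) (v : κ → E) (s : Finset κ) (W : Submodule ℝ E)
    (hu : ∃ u ∈ W, ∀ j ∈ s, a j + ⟪v j, u⟫ < 0) (R : ℝ) :
    ∃ C ≥ (0 : ℝ), ∀ x ∈ W, ‖x‖ ≤ R → ∀ r ≥ (0 : ℝ), (∀ j ∈ s, a j + ⟪v j, x⟫ ≤ r) →
      ∃ y ∈ W, (∀ j ∈ s, a j + ⟪v j, y⟫ ≤ 0) ∧ ‖x - y‖ ≤ C * r := by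
  obtain ⟨u, huW, hu⟩ := hu
  obtain ⟨m, hm, hmu⟩ : ∃ m > (0 : ℝ), ∀ j ∈ s, a j + ⟪v j, u⟫ ≤ -m := by
    rcases s.eq_empty_or_nonempty with rfl | hs
    · exact ⟨1, one_pos, by simp⟩
    · obtain ⟨k, hk, hmax⟩ := s.exists_max_image (fun j => a j + ⟪v j, u⟫) hs
      exact ⟨-(a k + ⟪v k, u⟫), by linarith [hu k hk], fun j hj => by simpa using hmax j hj⟩
  refine ⟨(‖u‖ + |R|) / m, by positivity, fun x hx hxR r hr hxr => ?_⟩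
  have hrm : 0 < r + m := by linarith
  refine ⟨x + (r / (r + m)) • (u - x), W.add_mem hx (W.smul_mem _ (W.sub_mem huW hx)),
    fun j hj => ?_, ?_⟩
  · have h : a j + ⟪v j, x + (r / (r + m)) • (u - x)⟫
        = (m * (a j + ⟪v j, x⟫) + r * (a j + ⟪v j, u⟫)) / (r + m) := by
      rw [inner_add_right, inner_smul_right, inner_sub_right]
      field_simp
      ring
    rw [h]
    apply div_nonpos_of_nonpos_of_nonneg _ hrm.le
    nlinarith [mul_le_mul_of_nonneg_left (hxr j hj) hm.le,
      mul_le_mul_of_nonneg_left (hmu j hj) hr]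
  · rw [sub_add_cancel_left, norm_neg, norm_smul, Real.norm_of_nonneg (by positivity)]
    have h1 : ‖u - x‖ ≤ ‖u‖ + |R| := (norm_sub_le _ _).trans (by linarith [le_abs_self R])
    calc r / (r + m) * ‖u - x‖ ≤ r / m * (‖u‖ + |R|) := by
          gcongr
          linarith
      _ = (‖u‖ + |R|) / m * r := by ring

/-- If an affine system solved by `0` has no Slater point in `W`, some constraint is homogeneous
and its violation in the opposite direction on `W` is controlled by the violation of the system. -/
theorem exists_implicit_equality [FiniteDimensional ℝ E] (a : κ → ℝ) (v : κ → E) (s : Finset κ)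
    (ha : ∀ j ∈ s, a j ≤ 0) (W : Submodule ℝ E)
    (hu : ¬ ∃ u ∈ W, ∀ j ∈ s, a j + ⟪v j, u⟫ < 0) :
    ∃ k ∈ s, a k = 0 ∧ ∃ c > (0 : ℝ), ∀ x ∈ W, ∀ r ≥ (0 : ℝ),
      (∀ j ∈ s, a j + ⟪v j, x⟫ ≤ r) → |⟪v k, x⟫| ≤ c * r := by
  classical
  have hproj : ∀ j, ∀ x ∈ W, ⟪W.starProjection (v j), x⟫ = ⟪v j, x⟫ := fun j x hx => by
    rw [Submodule.inner_starProjection_left_eq_right, Submodule.starProjection_eq_self_iff.2 hx]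
  set T := (s.filter (fun j => a j = 0)).image (fun j => W.starProjection (v j))
  have hT : ∀ u : E, ∃ w ∈ T, 0 ≤ ⟪w, u⟫ := by
    intro u
    by_contra! hcon
    have hneg : ∀ j ∈ s, a j = 0 → ⟪v j, W.starProjection u⟫ < 0 := fun j hj haj => by
      rw [← Submodule.inner_starProjection_left_eq_right]
      exact hcon _ (Finset.mem_image_of_mem _ (Finset.mem_filter.2 ⟨hj, haj⟩))
    have hev : ∀ᶠ t : ℝ in nhdsWithin 0 (Set.Ioi 0),
        ∀ j ∈ s, a j + ⟪v j, t • W.starProjection u⟫ < 0 := by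
      rw [Finset.eventually_all]
      intro j hj
      by_cases haj : a j = 0
      · filter_upwards [self_mem_nhdsWithin] with t ht
        rw [haj, zero_add, inner_smul_right]
        exact mul_neg_of_pos_of_neg ht (hneg j hj haj)
      · have hcont : Continuous fun t : ℝ => a j + ⟪v j, t • W.starProjection u⟫ := by fun_prop
        refine nhdsWithin_le_nhds (hcont.continuousAt.eventually_lt_const ?_)
        simpa using lt_of_le_of_ne (ha j hj) haj
    obtain ⟨t, ht⟩ := hev.exists
    exact hu ⟨_, W.smul_mem t (Submodule.starProjection_apply_mem W u), ht⟩
  have h0 := zero_mem_convexHull_of_forall_exists_inner_nonneg T hT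
  rw [Finset.mem_convexHull'] at h0
  obtain ⟨l, hl0, hl1, hl⟩ := h0
  obtain ⟨w, hwT, hw⟩ : ∃ w ∈ T, 0 < l w := by
    by_contra! hcon
    linarith [Finset.sum_nonpos hcon]
  obtain ⟨k, hk, rfl⟩ := Finset.mem_image.1 hwT
  rw [Finset.mem_filter] at hk
  refine ⟨k, hk.1, hk.2, 1 + 1 / l (W.starProjection (v k)), by positivity,
    fun x hx r hr hxr => ?_⟩
  have hTr : ∀ w ∈ T, ⟪w, x⟫ ≤ r := by
    intro w hw
    obtain ⟨j, hj, rfl⟩ := Finset.mem_image.1 hw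
    rw [Finset.mem_filter] at hj
    have := hxr j hj.1
    rw [hproj j x hx]
    linarith [hj.2]
  have hsum : ∑ w ∈ T, l w * (r - ⟪w, x⟫) = r := by
    have : ∑ w ∈ T, l w * ⟪w, x⟫ = 0 := by
      have := congrArg (fun z => ⟪z, x⟫) hl
      simpa [sum_inner, real_inner_smul_left] using this
    simp only [mul_sub, Finset.sum_sub_distrib, this, ← Finset.sum_mul, hl1]
    ring
  have hle := Finset.single_le_sum
    (fun w hw => mul_nonneg (hl0 w hw) (sub_nonneg.2 (hTr w hw))) hwT
  rw [hsum, hproj k x hx] at hle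
  have hkr := hTr _ hwT
  rw [hproj k x hx] at hkr
  have hq : r - ⟪v k, x⟫ ≤ 1 / l (W.starProjection (v k)) * r := by
    rw [one_div_mul_eq_div, le_div_iff₀ hw]
    linarith
  have hq0 : 0 ≤ 1 / l (W.starProjection (v k)) * r := by positivity
  rw [abs_le]
  constructor <;> linarith

/-- Hoffman's error bound on bounded subsets of a subspace, for a system solved by `0`. -/
theorem exists_error_bound_submodule [FiniteDimensional ℝ E] (a : κ → ℝ) (v : κ → E)
    (s : Finset κ) (ha : ∀ j ∈ s, a j ≤ 0) (W : Submodule ℝ E) (R : ℝ) :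
    ∃ C ≥ (0 : ℝ), ∀ x ∈ W, ‖x‖ ≤ R → ∀ r ≥ (0 : ℝ), (∀ j ∈ s, a j + ⟪v j, x⟫ ≤ r) →
      ∃ y ∈ W, (∀ j ∈ s, a j + ⟪v j, y⟫ ≤ 0) ∧ ‖x - y‖ ≤ C * r := by
  classical
  induction s using Finset.strongInduction generalizing W R with
  | H s ih =>
  by_cases hu : ∃ u ∈ W, ∀ j ∈ s, a j + ⟪v j, u⟫ < 0
  · exact exists_error_bound_of_slater a v s W hu R
  obtain ⟨k, hks, hak, c, hc, hck⟩ := exists_implicit_equality a v s ha W hu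
  set w := W.starProjection (v k) with hw
  have hwW : w ∈ W := Submodule.starProjection_apply_mem W _
  have hproj : ∀ x ∈ W, ⟪w, x⟫ = ⟪v k, x⟫ := fun x hx => by
    rw [hw, Submodule.inner_starProjection_left_eq_right,
      Submodule.starProjection_eq_self_iff.2 hx]
  obtain ⟨C, hC, hCW⟩ := ih (s.erase k) (Finset.erase_ssubset hks)
    (fun j hj => ha j (Finset.mem_of_mem_erase hj)) (W ⊓ (ℝ ∙ w)ᗮ) (R + R)
  set M := ∑ j ∈ s, ‖v j‖
  have hM0 : 0 ≤ M := Finset.sum_nonneg fun j _ => norm_nonneg _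
  refine ⟨c / ‖w‖ + C * (1 + M * (c / ‖w‖)), by positivity, fun x hx hxR r hr hxr => ?_⟩
  set z := (⟪w, x⟫ / ‖w‖ ^ 2) • w with hz
  have hznorm : ‖z‖ = |⟪w, x⟫| / ‖w‖ := by
    rw [hz, norm_smul, Real.norm_eq_abs, abs_div, abs_of_nonneg (sq_nonneg ‖w‖)]
    rcases eq_or_ne ‖w‖ 0 with h | h
    · simp [h]
    · field_simp
  have hzr : ‖z‖ ≤ c / ‖w‖ * r := by
    rw [hznorm, hproj x hx, div_mul_eq_mul_div]
    exact div_le_div_of_nonneg_right (hck x hx r hr hxr) (norm_nonneg _)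
  have hzx : ‖z‖ ≤ ‖x‖ := by
    rw [hznorm]
    exact div_le_of_le_mul₀ (norm_nonneg _) (norm_nonneg _)
      ((abs_real_inner_le_norm w x).trans_eq (mul_comm _ _))
  have horth : x - z ∈ W ⊓ (ℝ ∙ w)ᗮ := by
    refine ⟨W.sub_mem hx (W.smul_mem _ hwW), ?_⟩
    rw [SetLike.mem_coe, Submodule.mem_orthogonal_singleton_iff_inner_right, inner_sub_right, hz,
      inner_smul_right, real_inner_self_eq_norm_sq]
    rcases eq_or_ne w 0 with h | h
    · simp [h]
    · rw [div_mul_cancel₀ _ (by positivity), sub_self]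
  obtain ⟨y, hy, hyj, hyn⟩ := hCW (x - z) horth ((norm_sub_le _ _).trans (by linarith))
    ((1 + M * (c / ‖w‖)) * r) (by positivity) (fun j hj => by
      have hjs := Finset.mem_of_mem_erase hj
      have h1 : -⟪v j, z⟫ ≤ M * (c / ‖w‖ * r) := calc
        -⟪v j, z⟫ ≤ ‖v j‖ * ‖z‖ := (neg_le_abs _).trans (abs_real_inner_le_norm _ _)
        _ ≤ M * (c / ‖w‖ * r) := mul_le_mul
          (Finset.single_le_sum (f := fun j => ‖v j‖) (fun _ _ => norm_nonneg _) hjs)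
          hzr (norm_nonneg _) hM0
      rw [inner_sub_right]
      linarith [hxr j hjs])
  refine ⟨y, hy.1, fun j hj => ?_, ?_⟩
  · rcases eq_or_ne j k with rfl | hjk
    · rw [hak, ← hproj y hy.1, Submodule.mem_orthogonal_singleton_iff_inner_right.1 hy.2, zero_add]
    · exact hyj j (Finset.mem_erase.2 ⟨hjk, hj⟩)
  · calc ‖x - y‖ = ‖z + (x - z - y)‖ := by congr 1; abel
      _ ≤ ‖z‖ + ‖x - z - y‖ := norm_add_le _ _
      _ ≤ (c / ‖w‖ + C * (1 + M * (c / ‖w‖))) * r := by linarith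

/-- Hoffman's error bound on bounded sets, for a solvable finite system of affine inequalities. -/
theorem exists_error_bound_of_solvable [FiniteDimensional ℝ E] (a : κ → ℝ) (v : κ → E)
    (s : Finset κ) {p : E} (hp : ∀ j ∈ s, a j + ⟪v j, p⟫ ≤ 0) (R : ℝ) :
    ∃ C ≥ (0 : ℝ), ∀ x, ‖x‖ ≤ R → ∀ r ≥ (0 : ℝ), (∀ j ∈ s, a j + ⟪v j, x⟫ ≤ r) →
      ∃ y, (∀ j ∈ s, a j + ⟪v j, y⟫ ≤ 0) ∧ ‖x - y‖ ≤ C * r := by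
  obtain ⟨C, hC, h⟩ := exists_error_bound_submodule (fun j => a j + ⟪v j, p⟫) v s hp ⊤ (R + ‖p‖)
  refine ⟨C, hC, fun x hx r hr hxr => ?_⟩
  obtain ⟨y, -, hy, hyn⟩ := h (x - p) trivial ((norm_sub_le _ _).trans (by linarith)) r hr
    (fun j hj => by rw [inner_sub_right]; linarith [hxr j hj])
  refine ⟨y + p, fun j hj => ?_, ?_⟩
  · rw [inner_add_right]
    linarith [hy j hj]
  · rwa [← sub_sub, sub_right_comm]

end HoffmanBound

theorem stmt_8 {d : ℕ} {ι : Type*} [Fintype ι] [Nonempty ι]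
    {κ : ι → Type*} [∀ i, Fintype (κ i)] [∀ i, Nonempty (κ i)]
    (a : ∀ i, κ i → ℝ) (v : ∀ i, κ i → EuclideanSpace ℝ (Fin d))
    (f : EuclideanSpace ℝ (Fin d) → ℝ)
    (hf : ∀ x, f x = Finset.univ.inf' Finset.univ_nonempty
        (fun i => Finset.univ.sup' Finset.univ_nonempty (fun j => a i j + ⟪v i j, x⟫)))
    (hS : {x | f x ≤ 0}.Nonempty)
    (V : Set (EuclideanSpace ℝ (Fin d))) (hV : Bornology.IsBounded V) :
    ∃ τ > (0 : ℝ), ∀ x ∈ V, τ * Metric.infDist x {y | f y ≤ 0} ≤ max (f x) 0 := by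
  obtain ⟨x₀, hx₀⟩ := hS
  obtain ⟨R, hR⟩ := hV.subset_closedBall 0
  set F : ι → EuclideanSpace ℝ (Fin d) → ℝ := fun i x =>
    Finset.univ.sup' Finset.univ_nonempty (fun j => a i j + ⟪v i j, x⟫) with hF
  have hpiece : ∀ i, ∃ C ≥ (0 : ℝ), ∀ x ∈ V,
      Metric.infDist x {y | f y ≤ 0} ≤ C * max (F i x) 0 := by
    intro i
    by_cases hi : ∃ p, F i p ≤ 0
    · obtain ⟨p, hp⟩ := hi
      simp only [hF, Finset.sup'_le_iff] at hp
      obtain ⟨C, hC, h⟩ := exists_error_bound_of_solvable (a i) (v i) Finset.univ hp R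
      refine ⟨C, hC, fun x hx => ?_⟩
      obtain ⟨y, hy, hyn⟩ := h x (by simpa using hR hx) (max (F i x) 0) (le_max_right _ _)
        (fun j hj => (Finset.le_sup' (fun j => a i j + ⟪v i j, x⟫) hj).trans (le_max_left _ _))
      have hyS : y ∈ {y | f y ≤ 0} := by
        rw [Set.mem_ofPred_eq, hf]
        exact (Finset.inf'_le _ (Finset.mem_univ i)).trans (Finset.sup'_le _ _ hy)
      exact (Metric.infDist_le_dist_of_mem hyS).trans (by rwa [dist_eq_norm])
    · push Not at hi
      rcases V.eq_empty_or_nonempty with rfl | ⟨x₁, hx₁⟩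
      · exact ⟨0, le_rfl, by simp⟩
      have hcont : Continuous (F i) := by
        simp only [hF]
        exact Continuous.finset_sup'_apply _ fun j _ => by fun_prop
      obtain ⟨q, -, hq⟩ := (isCompact_closedBall (0 : EuclideanSpace ℝ (Fin d)) R).exists_isMinOn
        ⟨x₁, hR hx₁⟩ hcont.continuousOn
      have hR0 : 0 ≤ R := dist_nonneg.trans (hR hx₁)
      have hq0 := hi q
      refine ⟨(R + ‖x₀‖) / F i q, by positivity, fun x hx => ?_⟩
      have hxR : ‖x‖ ≤ R := by simpa using hR hx
      calc Metric.infDist x {y | f y ≤ 0} ≤ dist x x₀ := Metric.infDist_le_dist_of_mem hx₀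
        _ ≤ R + ‖x₀‖ := by rw [dist_eq_norm]; exact (norm_sub_le _ _).trans (by linarith)
        _ = (R + ‖x₀‖) / F i q * F i q := by field_simp
        _ ≤ (R + ‖x₀‖) / F i q * max (F i x) 0 := by
          gcongr
          exact (hq (hR hx)).trans (le_max_left _ _)
  choose C hC hCV using hpiece
  have hsum : 0 ≤ ∑ i, C i := Finset.sum_nonneg fun i _ => hC i
  refine ⟨(1 + ∑ i, C i)⁻¹, by positivity, fun x hx => ?_⟩
  obtain ⟨i, -, hi⟩ := Finset.exists_mem_eq_inf' Finset.univ_nonempty (fun i => F i x)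
  have hfi : f x = F i x := (hf x).trans hi
  rw [inv_mul_le_iff₀ (by positivity), hfi]
  refine (hCV i x hx).trans (mul_le_mul_of_nonneg_right ?_ (le_max_right _ _))
  linarith [Finset.single_le_sum (fun i _ => hC i) (Finset.mem_univ i)]
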